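/- Let Γ be a subgroup of O⁺(1,n) with ‖A − I‖ ≥ c for all non-identity A ∈ Γ (c > 0), let π : H^n → H^n/Γ be the quotient map, and let r > 0. Then the volume of H^n/Γ is at least Vol(B(e₁,r)) / N, where N = (2κ(r)²(n+1)²/c + 1)^{(n+1)²} and κ(r) = ((1+cosh r)/sinh r)√(cosh 6r). -/

import Mathlib

open Matrix

noncomputable def opNorm {m : Type*} [Fintype m] [DecidableEq m]
    (A : Matrix m m ℝ) : ℝ :=
  ‖(LinearMap.toContinuousLinearMap (Matrix.toEuclideanLin A))‖

/-- The Lorentz form matrix `J = diag(-1, 1, …, 1)`. -/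
noncomputable def Jmat (n : ℕ) : Matrix (Fin (n+1)) (Fin (n+1)) ℝ :=
  Matrix.diagonal fun i => if i = 0 then (-1 : ℝ) else 1

/-- `A ∈ O⁺(1,n)`: `A` preserves the Lorentz form and the upper sheet. -/
def OPlus {n : ℕ} (A : Matrix (Fin (n+1)) (Fin (n+1)) ℝ) : Prop :=
  Aᵀ * Jmat n * A = Jmat n ∧ 1 ≤ A 0 0

/-- The Lorentzian pairing `x₁y₁ − x₂y₂ − ⋯ − x_{n+1}y_{n+1}`. -/
noncomputable def lprod {n : ℕ} (x y : Fin (n+1) → ℝ) : ℝ :=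
  x 0 * y 0 - ∑ i ∈ Finset.univ.erase 0, x i * y i

/-- Membership in the hyperboloid model `H^n` (upper sheet). -/
def onH {n : ℕ} (x : Fin (n+1) → ℝ) : Prop :=
  lprod x x = 1 ∧ 0 < x 0

/-- Inverse hyperbolic cosine. -/
noncomputable def arcosh (x : ℝ) : ℝ := Real.log (x + Real.sqrt (x ^ 2 - 1))

/-- Hyperbolic distance on the hyperboloid: `cosh (dH x y) = lprod x y`. -/
noncomputable def dH {n : ℕ} (x y : Fin (n+1) → ℝ) : ℝ := arcosh (lprod x y)

/-- The point `e₁ = (1, 0, …, 0)` of the hyperboloid. -/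
noncomputable def e1vec (n : ℕ) : Fin (n+1) → ℝ := fun i => if i = 0 then 1 else 0

/-- The closed hyperbolic ball of radius `r` about `e₁` in the hyperboloid. -/
noncomputable def hBall (n : ℕ) (r : ℝ) : Set (Fin (n+1) → ℝ) :=
  {x | onH x ∧ dH (e1vec n) x ≤ r}

/-- `κ(r) = ((1 + cosh r)/sinh r) √(cosh 6r)`. -/
noncomputable def kappa (r : ℝ) : ℝ :=
  ((1 + Real.cosh r) / Real.sinh r) * Real.sqrt (Real.cosh (6 * r))

/-- The open hyperbolic ball of radius `r` about `e₁` in the hyperboloid. -/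
noncomputable def hBallOpen (n : ℕ) (r : ℝ) : Set (Fin (n+1) → ℝ) :=
  {x | onH x ∧ dH (e1vec n) x < r}

noncomputable def fro2 {m : Type*} [Fintype m] (A : Matrix m m ℝ) : ℝ := ∑ i, ∑ j, A i j ^ 2

lemma fro2_nonneg {m : Type*} [Fintype m] (A : Matrix m m ℝ) : 0 ≤ fro2 A :=
  Finset.sum_nonneg fun _ _ => Finset.sum_nonneg fun _ _ => sq_nonneg _

lemma fro2_mul {m : Type*} [Fintype m] (A B : Matrix m m ℝ) :
    fro2 (A * B) ≤ fro2 A * fro2 B := by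
  have h : ∀ i j, (A * B) i j ^ 2 ≤ (∑ k, A i k ^ 2) * (∑ k, B k j ^ 2) := by
    intro i j
    rw [Matrix.mul_apply]
    exact Finset.sum_mul_sq_le_sq_mul_sq _ _ _
  calc fro2 (A * B) ≤ ∑ i, ∑ j, (∑ k, A i k ^ 2) * (∑ k, B k j ^ 2) :=
        Finset.sum_le_sum fun i _ => Finset.sum_le_sum fun j _ => h i j
    _ = fro2 A * fro2 B := by
        unfold fro2
        rw [Finset.sum_comm (f := fun i j => B i j ^ 2), Finset.sum_mul_sum]

lemma opNorm_sq_le {m : Type*} [Fintype m] [DecidableEq m] (A : Matrix m m ℝ) :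
    opNorm A ^ 2 ≤ fro2 A := by
  have h : opNorm A ≤ √(fro2 A) := by
    unfold opNorm
    refine ContinuousLinearMap.opNorm_le_bound _ (Real.sqrt_nonneg _) fun v => ?_
    rw [EuclideanSpace.norm_eq, EuclideanSpace.norm_eq, ← Real.sqrt_mul (fro2_nonneg A)]
    apply Real.sqrt_le_sqrt
    unfold fro2
    rw [Finset.sum_mul]
    refine Finset.sum_le_sum fun i _ => ?_
    have := Finset.sum_mul_sq_le_sq_mul_sq Finset.univ (fun j => A i j) (fun j => v j)
    simpa [Matrix.toLpLin_apply, Matrix.mulVec, dotProduct] using this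
  have h0 : 0 ≤ opNorm A := norm_nonneg _
  calc opNorm A ^ 2 ≤ √(fro2 A) ^ 2 := by gcongr
    _ = fro2 A := Real.sq_sqrt (fro2_nonneg A)

lemma packing {ι : Type*} [Fintype ι] (R δ : ℝ) (hR : 0 ≤ R) (hδ : 0 < δ)
    (s : Finset (EuclideanSpace ℝ ι)) (hs : ∀ x ∈ s, ‖x‖ ≤ R)
    (hd : ∀ x ∈ s, ∀ y ∈ s, x ≠ y → δ ≤ dist x y) :
    (s.card : ℝ) ≤ (2 * R / δ + 1) ^ (Fintype.card ι) := by
  let E := EuclideanSpace ℝ ι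
  let μ : MeasureTheory.Measure E := MeasureTheory.volume
  have hdim : Module.finrank ℝ E = Fintype.card ι := finrank_euclideanSpace
  have hdis : (s : Set E).PairwiseDisjoint (fun x => Metric.ball x (δ/2)) := by
    intro x hx y hy hxy
    apply Metric.ball_disjoint_ball
    have := hd x hx y hy hxy
    linarith
  have hsub : (⋃ x ∈ s, Metric.ball x (δ/2)) ⊆ Metric.ball (0:E) (R + δ/2) := by
    intro z hz
    simp only [Set.mem_iUnion] at hz
    obtain ⟨x, hx, hz⟩ := hz
    rw [mem_ball_zero_iff]
    have h1 := hs x hx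
    have h2 : ‖z - x‖ < δ/2 := by rwa [Metric.mem_ball, dist_eq_norm] at hz
    have h3 : ‖z‖ ≤ ‖x‖ + ‖z - x‖ := by
      simpa using norm_add_le x (z - x)
    linarith
  have hm := MeasureTheory.measure_mono (μ := μ) hsub
  rw [MeasureTheory.measure_biUnion_finset hdis (fun x _ => measurableSet_ball)] at hm
  have hb : ∀ x : E, μ (Metric.ball x (δ/2)) = ENNReal.ofReal ((δ/2)^ (Fintype.card ι)) * μ (Metric.ball 0 1) := by
    intro x
    rw [← hdim]
    exact MeasureTheory.Measure.addHaar_ball_of_pos μ x (by positivity)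
  have hb2 : μ (Metric.ball (0:E) (R + δ/2)) = ENNReal.ofReal ((R + δ/2)^ (Fintype.card ι)) * μ (Metric.ball 0 1) := by
    rw [← hdim]
    exact MeasureTheory.Measure.addHaar_ball_of_pos μ 0 (by positivity)
  simp only [hb, hb2, Finset.sum_const, nsmul_eq_mul] at hm
  rw [← mul_assoc] at hm
  have h0 : μ (Metric.ball (0:E) 1) ≠ 0 := (Metric.measure_ball_pos μ _ one_pos).ne'
  have h1 : μ (Metric.ball (0:E) 1) ≠ ⊤ := MeasureTheory.measure_ball_lt_top.ne
  rw [ENNReal.mul_le_mul_iff_left h0 h1] at hm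
  rw [← ENNReal.ofReal_natCast, ← ENNReal.ofReal_mul (by positivity),
    ENNReal.ofReal_le_ofReal_iff (by positivity)] at hm
  have e : 2 * R / δ + 1 = (R + δ/2) / (δ/2) := by field_simp
  rw [e, div_pow, le_div_iff₀ (by positivity)]
  exact hm

lemma J_sq (n : ℕ) : Jmat n * Jmat n = 1 := by
  unfold Jmat
  rw [Matrix.diagonal_mul_diagonal, ← Matrix.diagonal_one]
  congr 1
  ext i
  split_ifs <;> norm_num

lemma OPlus.left_inv {n : ℕ} {A : Matrix (Fin (n+1)) (Fin (n+1)) ℝ} (h : OPlus A) :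
    (Jmat n * Aᵀ * Jmat n) * A = 1 := by
  rw [Matrix.mul_assoc, Matrix.mul_assoc, ← Matrix.mul_assoc Aᵀ, h.1, J_sq]

lemma OPlus.right_inv {n : ℕ} {A : Matrix (Fin (n+1)) (Fin (n+1)) ℝ} (h : OPlus A) :
    A * (Jmat n * Aᵀ * Jmat n) = 1 := mul_eq_one_comm.mp h.left_inv

lemma OPlus.inv_mul {n : ℕ} {A : Matrix (Fin (n+1)) (Fin (n+1)) ℝ} (h : OPlus A) :
    A⁻¹ * A = 1 := by
  rw [Matrix.inv_eq_left_inv h.left_inv, h.left_inv]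

lemma OPlus.mul_inv {n : ℕ} {A : Matrix (Fin (n+1)) (Fin (n+1)) ℝ} (h : OPlus A) :
    A * A⁻¹ = 1 := mul_eq_one_comm.mp h.inv_mul

lemma OPlus.fro2_inv {n : ℕ} {A : Matrix (Fin (n+1)) (Fin (n+1)) ℝ} (h : OPlus A) :
    fro2 A⁻¹ = fro2 A := by
  rw [Matrix.inv_eq_left_inv h.left_inv]
  unfold fro2
  rw [Finset.sum_comm]
  refine Finset.sum_congr rfl fun i _ => Finset.sum_congr rfl fun j _ => ?_
  simp only [Jmat, Matrix.mul_diagonal, Matrix.diagonal_mul, Matrix.transpose_apply]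
  split_ifs <;> ring

lemma OPlus.col {n : ℕ} {A : Matrix (Fin (n+1)) (Fin (n+1)) ℝ} (h : OPlus A) (j : Fin (n+1)) :
    ∑ i, A i j ^ 2 = 2 * A 0 j ^ 2 + (if j = 0 then -1 else 1) := by
  have h1 := congrFun (congrFun h.1 j) j
  rw [Matrix.mul_apply] at h1
  simp only [Jmat, Matrix.mul_diagonal, Matrix.diagonal_apply_eq, Matrix.transpose_apply] at h1
  rw [Fin.sum_univ_succ] at h1 ⊢
  simp only [Fin.succ_ne_zero, if_true, if_false] at h1
  rw [← h1]
  simp only [mul_one, sq]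
  ring

lemma OPlus.row {n : ℕ} {A : Matrix (Fin (n+1)) (Fin (n+1)) ℝ} (h : OPlus A) :
    A 0 0 ^ 2 - ∑ j : Fin n, A 0 j.succ ^ 2 = 1 := by
  have h2 : A * Jmat n * Aᵀ = Jmat n := by
    have := congrArg (· * Jmat n) h.right_inv
    simp only [Matrix.mul_assoc, J_sq, Matrix.one_mul, Matrix.mul_one] at this
    rw [Matrix.mul_assoc]; exact this
  have h1 := congrFun (congrFun h2 0) 0
  rw [Matrix.mul_apply] at h1
  simp only [Jmat, Matrix.mul_diagonal, Matrix.diagonal_apply_eq, Matrix.transpose_apply] at h1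
  rw [Fin.sum_univ_succ] at h1
  simp only [Fin.succ_ne_zero, if_true, if_false, mul_one, ← sq] at h1
  linarith

lemma OPlus.fro2_eq {n : ℕ} {A : Matrix (Fin (n+1)) (Fin (n+1)) ℝ} (h : OPlus A) :
    fro2 A = 4 * A 0 0 ^ 2 + n - 3 := by
  unfold fro2
  rw [Finset.sum_comm]
  simp only [h.col]
  rw [Fin.sum_univ_succ]
  simp only [Fin.succ_ne_zero, if_true, if_false, Finset.sum_add_distrib, ← Finset.mul_sum]
  have := h.row
  simp
  linarith

/-- packing bound for the elements of bounded Frobenius norm -/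
lemma card_bound {n : ℕ} {c : ℝ} (hc : 0 < c)
    {Γ : Set (Matrix (Fin (n+1)) (Fin (n+1)) ℝ)}
    (hsub : ∀ A ∈ Γ, OPlus A)
    (hmul : ∀ A ∈ Γ, ∀ B ∈ Γ, A * B ∈ Γ)
    (hinv : ∀ A ∈ Γ, A⁻¹ ∈ Γ)
    (hsep : ∀ A ∈ Γ, A ≠ 1 → c ≤ opNorm (A - 1))
    (K : ℝ) (hK : 0 < K) (T : Finset (Matrix (Fin (n+1)) (Fin (n+1)) ℝ))
    (hT : ∀ A ∈ T, A ∈ Γ ∧ fro2 A ≤ K) :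
    (T.card : ℝ) ≤ (2 * K / c + 1) ^ ((n+1)^2) := by
  classical
  let f : Matrix (Fin (n+1)) (Fin (n+1)) ℝ → EuclideanSpace ℝ (Fin (n+1) × Fin (n+1)) :=
    fun A => WithLp.toLp 2 fun p => A p.1 p.2
  have hf : Function.Injective f := by
    intro A B h
    ext i j
    have := congrFun (congrArg WithLp.ofLp h) (i, j)
    exact this
  have hn : ∀ A, ‖f A‖ ^ 2 = fro2 A := by
    intro A
    rw [EuclideanSpace.norm_sq_eq, Fintype.sum_prod_type]
    simp [f, fro2]
  have hsK : 0 < √K := Real.sqrt_pos.2 hK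
  have hKK : √K ^ 2 = K := Real.sq_sqrt hK.le
  have key := packing (√K) (c / √K) hsK.le (by positivity) (T.image f) ?_ ?_
  · rw [Finset.card_image_of_injective _ hf] at key
    have e : 2 * √K / (c / √K) = 2 * K / c := by
      rw [div_div_eq_mul_div, mul_assoc, ← sq, hKK]
    rw [e] at key
    simpa [sq] using key
  · intro x hx
    obtain ⟨A, hA, rfl⟩ := Finset.mem_image.1 hx
    apply Real.le_sqrt_of_sq_le
    rw [hn]; exact (hT A hA).2
  · intro x hx y hy hxy
    obtain ⟨A, hA, rfl⟩ := Finset.mem_image.1 hx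
    obtain ⟨B, hB, rfl⟩ := Finset.mem_image.1 hy
    have hAB : A ≠ B := fun h => hxy (by rw [h])
    obtain ⟨hAΓ, hAK⟩ := hT A hA
    obtain ⟨hBΓ, hBK⟩ := hT B hB
    have oA := hsub A hAΓ
    have h1 : B⁻¹ * A ≠ 1 := by
      intro h
      apply hAB
      have := congrArg (B * ·) h
      simpa [← Matrix.mul_assoc, (hsub B hBΓ).mul_inv] using this
    have h2 := hsep _ (hmul _ (hinv B hBΓ) _ hAΓ) h1
    have h3 : B⁻¹ * A - 1 = B⁻¹ * (A - B) := by
      rw [Matrix.mul_sub, (hsub B hBΓ).inv_mul]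
    rw [h3] at h2
    have h4 := opNorm_sq_le (B⁻¹ * (A - B))
    have h5 := fro2_mul B⁻¹ (A - B)
    rw [(hsub B hBΓ).fro2_inv] at h5
    have h6 : dist (f A) (f B) ^ 2 = fro2 (A - B) := by
      rw [dist_eq_norm, ← hn]
      rfl
    rw [div_le_iff₀ hsK]
    apply le_of_sq_le_sq _ (by positivity)
    rw [mul_pow, hKK, h6]
    calc c ^ 2 ≤ opNorm (B⁻¹ * (A - B)) ^ 2 := by gcongr
      _ ≤ fro2 B * fro2 (A - B) := h4.trans h5
      _ ≤ K * fro2 (A - B) := by gcongr; exact fro2_nonneg _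
      _ = _ := mul_comm _ _

lemma lprod_e1 {n : ℕ} (x : Fin (n+1) → ℝ) : lprod (e1vec n) x = x 0 := by
  unfold lprod e1vec
  rw [Finset.sum_eq_zero]
  · simp
  · intro i hi
    simp [Finset.ne_of_mem_erase hi]

lemma lprod_succ {n : ℕ} (x y : Fin (n+1) → ℝ) :
    lprod x y = x 0 * y 0 - ∑ i : Fin n, x i.succ * y i.succ := by
  unfold lprod
  have := Finset.add_sum_erase Finset.univ (fun i => x i * y i) (Finset.mem_univ (0 : Fin (n+1)))
  rw [Fin.sum_univ_succ] at this
  linarith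

lemma onH.sum {n : ℕ} {x : Fin (n+1) → ℝ} (h : onH x) :
    ∑ i : Fin n, x i.succ ^ 2 = x 0 ^ 2 - 1 := by
  have := h.1
  rw [lprod_succ] at this
  simp only [sq]
  linarith

lemma ball_bd {n : ℕ} {r : ℝ} {x : Fin (n+1) → ℝ} (h : x ∈ hBallOpen n r) :
    1 ≤ x 0 ∧ x 0 + √(x 0 ^ 2 - 1) < Real.exp r := by
  obtain ⟨hH, hd⟩ := h
  have h1 : 0 ≤ x 0 ^ 2 - 1 := by
    rw [← hH.sum]; positivity
  have h2 : 1 ≤ x 0 := by nlinarith [hH.2]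
  refine ⟨h2, ?_⟩
  unfold dH arcosh at hd
  rw [lprod_e1] at hd
  exact (Real.log_lt_iff_lt_exp (by have := Real.sqrt_nonneg (x 0 ^ 2 - 1); linarith)).1 hd

lemma a_bound {n : ℕ} {r : ℝ} {x : Fin (n+1) → ℝ}
    {A : Matrix (Fin (n+1)) (Fin (n+1)) ℝ} (hA : OPlus A)
    (hx : x ∈ hBallOpen n r) (hy : A.mulVec x ∈ hBallOpen n r) :
    2 * A 0 0 ≤ Real.exp r ^ 2 + 1 := by
  obtain ⟨hx1, hx2⟩ := ball_bd hx
  obtain ⟨hy1, hy2⟩ := ball_bd hy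
  have hy0 : (A.mulVec x) 0 = A 0 0 * x 0 + ∑ j : Fin n, A 0 j.succ * x j.succ := by
    simp [Matrix.mulVec, dotProduct, Fin.sum_univ_succ]
  set y0 := (A.mulVec x) 0
  set S := ∑ j : Fin n, A 0 j.succ * x j.succ
  have ha := hA.2
  set a := A 0 0 with ha_def
  have hS : S ^ 2 ≤ (a ^ 2 - 1) * (x 0 ^ 2 - 1) := by
    have := Finset.sum_mul_sq_le_sq_mul_sq Finset.univ (fun j : Fin n => A 0 j.succ)
      (fun j : Fin n => x j.succ)
    rw [hx.1.sum] at this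
    have h2 := hA.row
    have h3 : ∑ j : Fin n, A 0 j.succ ^ 2 = a ^ 2 - 1 := by linarith
    rw [h3] at this
    exact this
  set s := √(x 0 ^ 2 - 1) with hs
  have hs2 : s ^ 2 = x 0 ^ 2 - 1 := Real.sq_sqrt (by nlinarith)
  have hs0 : 0 ≤ s := Real.sqrt_nonneg _
  set w := √(y0 ^ 2 - 1) with hw
  have hw2 : w ^ 2 = y0 ^ 2 - 1 := Real.sq_sqrt (by nlinarith)
  have hw0 : 0 ≤ w := Real.sqrt_nonneg _
  have hSs : -(a * s) ≤ S := by
    apply neg_le_of_abs_le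
    apply abs_le_of_sq_le_sq _ (by positivity)
    rw [mul_pow, hs2]
    nlinarith [sq_nonneg s]
  set E := Real.exp r
  have h1 : a ≤ y0 * (x 0 + s) := by
    have : a * (x 0 - s) ≤ y0 := by rw [hy0]; linarith
    calc a = a * (x 0 - s) * (x 0 + s) := by
          have : (x 0 - s) * (x 0 + s) = 1 := by ring_nf; linarith
          rw [mul_assoc, this, mul_one]
      _ ≤ y0 * (x 0 + s) := by gcongr
  -- `2 y0 E ≤ E^2 + 1`
  have h2 : 2 * y0 * E ≤ E ^ 2 + 1 := by
    have h3 : 0 ≤ (E - (y0 + w)) * (E - (y0 - w)) :=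
      mul_nonneg (by linarith) (by linarith)
    nlinarith
  have h4 : y0 * (x 0 + s) ≤ y0 * E := by gcongr
  linarith

lemma kappa_bound (n : ℕ) (r : ℝ) (hr : 0 < r) (a : ℝ) (ha : 1 ≤ a)
    (h0 : n = 0 → a = 1) (h : 2 * a ≤ Real.exp r ^ 2 + 1) :
    4 * a ^ 2 + n - 3 ≤ kappa r ^ 2 * (n + 1) ^ 2 := by
  have hk : Real.cosh (6 * r) ≤ kappa r ^ 2 := by
    unfold kappa
    rw [mul_pow, Real.sq_sqrt (Real.cosh_pos _).le]
    have hs : 0 < Real.sinh r := Real.sinh_pos_iff.2 hr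
    have : 1 ≤ (1 + Real.cosh r) / Real.sinh r := by
      rw [le_div_iff₀ hs]
      linarith [Real.sinh_lt_cosh r]
    exact le_mul_of_one_le_left (Real.cosh_pos _).le (one_le_pow₀ this)
  refine le_trans ?_ (mul_le_mul_of_nonneg_right hk (by positivity))
  rcases Nat.eq_zero_or_pos n with hn | hn
  · rw [h0 hn, hn]
    have := Real.one_le_cosh (6 * r)
    norm_num
  · set t := Real.exp r ^ 2 with ht
    have ht1 : 1 ≤ t := one_le_pow₀ (Real.one_le_exp hr.le)
    have hc : t ^ 3 / 2 ≤ Real.cosh (6 * r) := by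
      rw [Real.cosh_eq]
      have : Real.exp (6 * r) = t ^ 3 := by
        rw [ht, ← pow_mul, ← Real.exp_nat_mul]; norm_num
      rw [this]
      have := Real.exp_pos (-(6 * r))
      linarith
    refine le_trans ?_ (mul_le_mul_of_nonneg_right hc (by positivity))
    have hn1 : (1 : ℝ) ≤ n := by exact_mod_cast hn
    have h4 : 4 * a ^ 2 ≤ (t + 1) ^ 2 := by nlinarith
    have h5 : 0 ≤ (2 * t - 1) * (t ^ 2 - 1) := mul_nonneg (by linarith) (by nlinarith)
    have h6 : (1:ℝ) ≤ t ^ 3 := one_le_pow₀ ht1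
    have h7 : (n - 1 : ℝ) ≤ (n - 1) * (n + 3) / 2 * t ^ 3 := by
      have : (n - 1 : ℝ) ≤ (n - 1) * (n + 3) / 2 := by nlinarith
      exact this.trans (le_mul_of_one_le_right (by nlinarith) h6)
    nlinarith

lemma measurable_ball (n : ℕ) (r : ℝ) : MeasurableSet (hBallOpen n r) := by
  have hm : Measurable (fun x : Fin (n+1) → ℝ => lprod x x) := by
    unfold lprod; fun_prop
  have hm2 : Measurable (fun x : Fin (n+1) → ℝ => dH (e1vec n) x) := by
    unfold dH arcosh
    simp only [lprod_e1]
    fun_prop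
  unfold hBallOpen onH
  exact ((measurableSet_eq_fun hm measurable_const).inter
    (measurableSet_lt measurable_const (measurable_pi_apply 0))).inter
    (measurableSet_lt hm2 measurable_const)

/-- The volume of `H^n/Γ` — i.e. the volume of any (measure-theoretic)
fundamental domain `F` for the action of `Γ` on the hyperboloid with respect to
a `Γ`-invariant volume measure `μ` — is at least `Vol(B(e₁,r)) / N`. -/
theorem stmt_18 (n : ℕ) (c : ℝ) (hc : 0 < c)
    (Γ : Set (Matrix (Fin (n+1)) (Fin (n+1)) ℝ))
    (hsub : ∀ A ∈ Γ, OPlus A)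
    (hone : (1 : Matrix (Fin (n+1)) (Fin (n+1)) ℝ) ∈ Γ)
    (hmul : ∀ A ∈ Γ, ∀ B ∈ Γ, A * B ∈ Γ)
    (hinv : ∀ A ∈ Γ, A⁻¹ ∈ Γ)
    (hsep : ∀ A ∈ Γ, A ≠ 1 → c ≤ opNorm (A - 1))
    (μ : MeasureTheory.Measure (Fin (n+1) → ℝ))
    (hμinv : ∀ A ∈ Γ, MeasureTheory.Measure.map (A.mulVec) μ = μ)
    (F : Set (Fin (n+1) → ℝ)) (hF : MeasurableSet F)
    (hFsub : F ⊆ {x | onH x})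
    (hcover : ∀ x, onH x → ∃ A ∈ Γ, A.mulVec x ∈ F)
    (hdisj : ∀ A ∈ Γ, A ≠ 1 → μ (F ∩ (A.mulVec '' F)) = 0)
    (r : ℝ) (hr : 0 < r) :
    μ (hBallOpen n r) /
        ENNReal.ofReal ((2 * kappa r ^ 2 * (n + 1) ^ 2 / c + 1) ^ ((n + 1) ^ 2))
      ≤ μ F := by
  classical
  set K := kappa r ^ 2 * ((n:ℝ) + 1) ^ 2 with hKdef
  have hKpos : 0 < K := by
    have hs : 0 < Real.sinh r := Real.sinh_pos_iff.2 hr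
    have := Real.cosh_pos r
    have h6 := Real.cosh_pos (6 * r)
    have hk : 0 < kappa r := by unfold kappa; positivity
    positivity
  have e : 2 * kappa r ^ 2 * ((n:ℝ) + 1) ^ 2 / c + 1 = 2 * K / c + 1 := by
    rw [hKdef]; ring
  rw [e]
  set N : ℝ := (2 * K / c + 1) ^ ((n + 1) ^ 2) with hN
  have hNpos : 0 < N := by positivity
  -- countability of the group
  have hcount : Γ.Countable := by
    have hfin : ∀ k : ℕ, {A | A ∈ Γ ∧ fro2 A ≤ k + 1}.Finite := by
      intro k
      by_contra hinf
      obtain ⟨T, hT, hTc⟩ := Set.Infinite.exists_subset_card_eq hinf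
        (⌈(2 * ((k:ℝ) + 1) / c + 1) ^ ((n+1)^2)⌉₊ + 1)
      have := card_bound hc hsub hmul hinv hsep ((k:ℝ) + 1) (by positivity) T
        (fun A hA => hT hA)
      rw [hTc] at this
      push_cast at this
      have h2 := Nat.le_ceil ((2 * ((k:ℝ) + 1) / c + 1) ^ ((n+1)^2))
      linarith
    refine (Set.countable_iUnion fun k => (hfin k).countable).mono ?_
    intro A hA
    obtain ⟨k, hk⟩ := exists_nat_ge (fro2 A)
    exact Set.mem_iUnion.2 ⟨k, hA, by linarith⟩
  have : Countable Γ := hcount.to_subtype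
  set B := hBallOpen n r with hB
  have hBm : MeasurableSet B := measurable_ball n r
  have hmeas : ∀ A : Matrix (Fin (n+1)) (Fin (n+1)) ℝ, Measurable A.mulVec := fun A =>
    (Continuous.matrix_mulVec continuous_const continuous_id).measurable
  have hcov : B ⊆ ⋃ A : Γ, (B ∩ A.1.mulVec ⁻¹' F) := by
    intro x hx
    obtain ⟨A, hA, hAF⟩ := hcover x hx.1
    exact Set.mem_iUnion.2 ⟨⟨A, hA⟩, hx, hAF⟩
  have hG : ∀ A : Γ, MeasurableSet (A.1⁻¹.mulVec ⁻¹' B) := fun A => hmeas _ hBm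
  have heq : ∀ A : Γ, μ (B ∩ A.1.mulVec ⁻¹' F) = μ ((A.1⁻¹.mulVec ⁻¹' B) ∩ F) := by
    intro A
    conv_rhs => rw [← hμinv A.1 A.2]
    rw [MeasureTheory.Measure.map_apply (hmeas _) ((hG A).inter hF), Set.preimage_inter]
    congr 2
    ext x
    simp [Matrix.mulVec_mulVec, (hsub A.1 A.2).inv_mul]
  -- pointwise multiplicity bound
  have hmult : ∀ y, ∑' A : Γ, (A.1⁻¹.mulVec ⁻¹' B).indicator (1 : (Fin (n+1) → ℝ) → ENNReal) y
      ≤ ENNReal.ofReal N := by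
    intro y
    rw [ENNReal.tsum_eq_iSup_sum]
    refine iSup_le fun T => ?_
    have h1 : ∑ A ∈ T, (A.1⁻¹.mulVec ⁻¹' B).indicator (1 : (Fin (n+1) → ℝ) → ENNReal) y
        = ((T.filter fun A => A.1⁻¹.mulVec y ∈ B).card : ENNReal) := by
      simp [Set.indicator_apply, Finset.sum_ite]
    rw [h1, ← ENNReal.ofReal_natCast]
    apply ENNReal.ofReal_le_ofReal
    set T' := T.filter fun A => A.1⁻¹.mulVec y ∈ B with hT'
    rcases T'.eq_empty_or_nonempty with h | ⟨A₁, hA₁⟩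
    · rw [h]; simpa using hNpos.le
    have hinj : Function.Injective (fun A : Γ => A.1⁻¹ * A₁.1) := by
      intro A A' h
      have h2 : A.1⁻¹ = A'.1⁻¹ := by
        have := congrArg (· * A₁.1⁻¹) h
        simpa [Matrix.mul_assoc, (hsub A₁.1 A₁.2).mul_inv] using this
      apply Subtype.ext
      have h3 := congrArg (fun M => A.1 * M * A'.1) h2
      simp only [(hsub A.1 A.2).mul_inv, Matrix.mul_assoc, (hsub A'.1 A'.2).inv_mul,
        Matrix.mul_one] at h3
      rw [Matrix.one_mul] at h3
      exact h3.symm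
    rw [← Finset.card_image_of_injective T' hinj]
    apply card_bound hc hsub hmul hinv hsep K hKpos
    intro M hM
    obtain ⟨A, hA, rfl⟩ := Finset.mem_image.1 hM
    have hMΓ : A.1⁻¹ * A₁.1 ∈ Γ := hmul _ (hinv _ A.2) _ A₁.2
    refine ⟨hMΓ, ?_⟩
    have hO := hsub _ hMΓ
    rw [hO.fro2_eq]
    have hA1 := (Finset.mem_filter.1 hA₁).2
    have hA2 := (Finset.mem_filter.1 hA).2
    refine kappa_bound n r hr _ hO.2 ?_ (a_bound hO hA1 ?_)
    · intro hn
      subst hn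
      have h3 := hO.row
      have h4 := hO.2
      simp only [Finset.univ_eq_empty, Finset.sum_empty] at h3
      nlinarith
    · rw [Matrix.mulVec_mulVec, Matrix.mul_assoc, (hsub A₁.1 A₁.2).mul_inv, Matrix.mul_one]
      exact hA2
  apply ENNReal.div_le_of_le_mul
  calc μ B ≤ ∑' A : Γ, μ (B ∩ A.1.mulVec ⁻¹' F) :=
        (MeasureTheory.measure_mono hcov).trans (MeasureTheory.measure_iUnion_le _)
    _ = ∑' A : Γ, ∫⁻ y in F, (A.1⁻¹.mulVec ⁻¹' B).indicator (1 : (Fin (n+1) → ℝ) → ENNReal) y ∂μ := by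
        refine tsum_congr fun A => ?_
        rw [heq, MeasureTheory.lintegral_indicator_one (hG A),
          MeasureTheory.Measure.restrict_apply (hG A)]
    _ = ∫⁻ y in F, ∑' A : Γ, (A.1⁻¹.mulVec ⁻¹' B).indicator (1 : (Fin (n+1) → ℝ) → ENNReal) y ∂μ := by
        rw [MeasureTheory.lintegral_tsum]
        intro A
        exact (measurable_one.indicator (hG A)).aemeasurable
    _ ≤ ∫⁻ y in F, ENNReal.ofReal N ∂μ := MeasureTheory.lintegral_mono hmult
    _ = μ F * ENNReal.ofReal N := by
        rw [MeasureTheory.setLIntegral_const, mul_comm]
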